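/- arXiv:1610.06509 — 6 statements merged into one kernel-verified Lean document; each statement's English description precedes it below -/
import Mathlib

section
/- Let R be a left coherent ring and let (𝒳,𝒴) be a torsion pair in fp(R-Mod). Then (lim→𝒳, lim→𝒴) is a tCG torsion pair in R-Mod; in particular, lim→𝒴 = {M ∈ R-Mod : Hom_R(X, M) = 0 for all X ∈ 𝒳}. -/
open CategoryTheory Limits DirectSum

universe w u

variable (R : Type u) [Ring R]

/-- A torsion pair `(T, F)` in the category of left `R`-modules: both classes are closed
under isomorphism, all homomorphisms from `T` to `F` vanish, and every module has a
torsion submodule in `T` with torsion-free quotient in `F`. -/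
structure ModTorsionPair (T F : ModuleCat.{u} R → Prop) : Prop where
  iso_closed_torsion : ∀ {M N : ModuleCat.{u} R}, (M ≅ N) → T M → T N
  iso_closed_torsionfree : ∀ {M N : ModuleCat.{u} R}, (M ≅ N) → F M → F N
  hom_eq_zero : ∀ {M N : ModuleCat.{u} R}, T M → F N → ∀ f : M →ₗ[R] N, f = 0
  exists_torsion_submodule : ∀ M : ModuleCat.{u} R, ∃ t : Submodule R M,
    T (ModuleCat.of R t) ∧ F (ModuleCat.of R (M ⧸ t))

/-- The torsion pair `(T, F)` is tCG: there is a set of finitely presented modules in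
the torsion class `T` whose simultaneous `Hom`-vanishing cuts out exactly the
torsion-free class `F`. -/
def IsTCGTorsionPair (T F : ModuleCat.{u} R → Prop) : Prop :=
  ∃ (Λ : Type u) (Tfam : Λ → ModuleCat.{u} R),
    (∀ l, Module.FinitePresentation R (Tfam l)) ∧ (∀ l, T (Tfam l)) ∧
    ∀ M : ModuleCat.{u} R, F M ↔ ∀ (l : Λ) (f : Tfam l →ₗ[R] M), f = 0

/-- `R` is left coherent: every finitely generated left ideal is finitely presented
as a left `R`-module. -/
def LeftCoherent : Prop :=
  ∀ I : Submodule R R, I.FG → Module.FinitePresentation R I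

/-- A torsion pair `(X, Y)` in the category `fp(R-Mod)` of finitely presented left
`R`-modules. -/
structure FpTorsionPair (X Y : ModuleCat.{u} R → Prop) : Prop where
  fp_left : ∀ M, X M → Module.FinitePresentation R M
  fp_right : ∀ M, Y M → Module.FinitePresentation R M
  iso_closed_left : ∀ {M N : ModuleCat.{u} R}, (M ≅ N) → X M → X N
  iso_closed_right : ∀ {M N : ModuleCat.{u} R}, (M ≅ N) → Y M → Y N
  hom_eq_zero : ∀ {M N : ModuleCat.{u} R}, X M → Y N → ∀ f : M →ₗ[R] N, f = 0
  exists_torsion_submodule : ∀ M : ModuleCat.{u} R, Module.FinitePresentation R M →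
    ∃ t : Submodule R M, X (ModuleCat.of R t) ∧ Y (ModuleCat.of R (M ⧸ t))

/-- A presentation of `M` as a direct limit (filtered colimit) of modules in the class `X`. -/
structure DirectLimitPresentation (X : ModuleCat.{u} R → Prop) (M : ModuleCat.{u} R) where
  J : Type u
  [instCat : SmallCategory J]
  [instFil : IsFiltered J]
  D : J ⥤ ModuleCat.{u} R
  c : Cocone D
  isColimit : IsColimit c
  mem : ∀ j, X (D.obj j)
  iso : c.pt ≅ M

/-- `lim→ X`: the class of modules isomorphic to a direct limit of modules in `X`. -/
def LimClass (X : ModuleCat.{u} R → Prop) (M : ModuleCat.{u} R) : Prop :=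
  Nonempty (DirectLimitPresentation R X M)

/-- A cocone over a filtered diagram of modules is a colimit if it is jointly surjective and
every element it kills is already killed at some later stage. -/
theorem ModuleCat.nonempty_isColimit_of_filtered {J : Type u} [SmallCategory J] [IsFiltered J]
    {D : J ⥤ ModuleCat.{u} R} (c : Cocone D)
    (hsurj : ∀ y : c.pt, ∃ (j : J) (x : D.obj j), c.ι.app j x = y)
    (hker : ∀ (j : J) (x : D.obj j), c.ι.app j x = 0 → ∃ (k : J) (f : j ⟶ k), D.map f x = 0) :
    Nonempty (IsColimit c) := by
  refine ⟨isColimitOfReflects (forget (ModuleCat.{u} R)) ?_⟩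
  refine Types.FilteredColimit.isColimitOf _ _ ?_ ?_
  · intro y
    obtain ⟨j, x, hx⟩ := hsurj y
    exact ⟨j, x, hx.symm⟩
  · intro i j x y hxy
    replace hxy : c.ι.app i x = c.ι.app j y := hxy
    obtain ⟨k, f, hf⟩ := hker (IsFiltered.max i j)
      (D.map (IsFiltered.leftToMax i j) x - D.map (IsFiltered.rightToMax i j) y) (by
        rw [map_sub, sub_eq_zero, ← ConcreteCategory.comp_apply, ← ConcreteCategory.comp_apply,
          c.w, c.w, hxy])
    refine ⟨k, IsFiltered.leftToMax i j ≫ f, IsFiltered.rightToMax i j ≫ f, ?_⟩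
    rw [map_sub, sub_eq_zero, ← ConcreteCategory.comp_apply, ← ConcreteCategory.comp_apply,
      ← D.map_comp, ← D.map_comp] at hf
    exact hf

theorem ModuleCat.exists_map_eq_zero_of_isColimit {J : Type u} [SmallCategory J] [IsFiltered J]
    {D : J ⥤ ModuleCat.{u} R} {c : Cocone D} (hc : IsColimit c) (j : J) (x : D.obj j)
    (hx : c.ι.app j x = 0) : ∃ (k : J) (f : j ⟶ k), D.map f x = 0 := by
  obtain ⟨k, f, g, h⟩ := Concrete.isColimit_exists_of_rep_eq D hc x (0 : D.obj j)
    (by rw [hx, map_zero])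
  exact ⟨k, f, by rw [h, map_zero]⟩

theorem ModuleCat.exists_map_eq_zero_of_finite {J : Type u} [SmallCategory J] [IsFiltered J]
    {D : J ⥤ ModuleCat.{u} R} {c : Cocone D} (hc : IsColimit c) (j : J) {s : Set (D.obj j)}
    (hs : s.Finite) (h0 : ∀ x ∈ s, c.ι.app j x = 0) :
    ∃ (k : J) (f : j ⟶ k), ∀ x ∈ s, D.map f x = 0 := by
  induction s, hs using Set.Finite.induction_on with
  | empty => exact ⟨j, 𝟙 j, by simp⟩
  | @insert a s _ _ ih =>
    obtain ⟨k, f, hf⟩ := ih fun x hx => h0 x (Set.mem_insert_of_mem a hx)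
    obtain ⟨l, g, hg⟩ := exists_map_eq_zero_of_isColimit R hc j a (h0 a (Set.mem_insert a s))
    refine ⟨IsFiltered.coeq (f ≫ IsFiltered.leftToMax k l) (g ≫ IsFiltered.rightToMax k l),
      (f ≫ IsFiltered.leftToMax k l) ≫ IsFiltered.coeqHom _ _, ?_⟩
    rintro x (rfl | hx)
    · rw [IsFiltered.coeq_condition]
      simp [hg]
    · simp [hf x hx]

/-- A map from a finitely presented module to a filtered colimit factors through some stage. -/
theorem Module.FinitePresentation.exists_factor_of_isColimit {J : Type u} [SmallCategory J]
    [IsFiltered J] {D : J ⥤ ModuleCat.{u} R} {c : Cocone D} (hc : IsColimit c)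
    {P : Type u} [AddCommGroup P] [Module R P] [Module.FinitePresentation R P]
    (f : P →ₗ[R] c.pt) :
    ∃ (j : J) (g : P →ₗ[R] D.obj j), (c.ι.app j).hom ∘ₗ g = f := by
  classical
  obtain ⟨n, π, hπ⟩ := Module.Finite.exists_fin' R P
  have hK : (LinearMap.ker π).FG := Module.FinitePresentation.fg_ker π hπ
  choose i x hx using fun a : Fin n =>
    Concrete.isColimit_exists_rep D hc (f (π (Pi.single a 1)))
  obtain ⟨j, hj⟩ := IsFiltered.sup_objs_exists (Finset.univ.image i)
  have hj' : ∀ a, Nonempty (i a ⟶ j) := fun a => hj (by simp)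
  let h : (Fin n → R) →ₗ[R] D.obj j :=
    (Pi.basisFun R (Fin n)).constr ℕ fun a => D.map (hj' a).some (x a)
  have hh : (c.ι.app j).hom ∘ₗ h = f ∘ₗ π := by
    refine (Pi.basisFun R (Fin n)).ext fun a => ?_
    simp only [h, LinearMap.comp_apply, Module.Basis.constr_basis]
    rw [Pi.basisFun_apply, ← hx a]
    change c.ι.app j (D.map (hj' a).some (x a)) = _
    rw [← ConcreteCategory.comp_apply, c.w]
  obtain ⟨s, hs⟩ := hK
  obtain ⟨k, g, hg⟩ := ModuleCat.exists_map_eq_zero_of_finite R hc j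
    (s := h '' (s : Set (Fin n → R))) (s.finite_toSet.image h) (by
      rintro _ ⟨y, hy, rfl⟩
      have hy' : π y = 0 := by
        have : y ∈ LinearMap.ker π := hs ▸ Submodule.subset_span hy
        exact this
      have := LinearMap.congr_fun hh y
      simpa [hy'] using this)
  have hle : LinearMap.ker π ≤ LinearMap.ker ((D.map g).hom ∘ₗ h) := by
    rw [← hs, Submodule.span_le]
    intro y hy
    exact hg _ ⟨y, hy, rfl⟩
  let e := π.quotKerEquivOfSurjective hπ
  refine ⟨k, (LinearMap.ker π).liftQ _ hle ∘ₗ e.symm.toLinearMap, ?_⟩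
  ext p
  obtain ⟨y, rfl⟩ := hπ p
  have he : e.symm (π y) = (LinearMap.ker π).mkQ y := by
    rw [LinearEquiv.symm_apply_eq]; rfl
  have := LinearMap.congr_fun hh y
  simp only [LinearMap.comp_apply, LinearEquiv.coe_coe, he, Submodule.mkQ_apply,
    Submodule.liftQ_apply] at this ⊢
  rw [← this]
  change c.ι.app k (D.map g (h y)) = c.ι.app j (h y)
  rw [← ConcreteCategory.comp_apply, c.w]

theorem LimClass.hom_eq_zero_of_finitePresentation {Y : ModuleCat.{u} R → Prop}
    {N M : ModuleCat.{u} R} [Module.FinitePresentation R N] (hM : LimClass R Y M)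
    (h : ∀ {L : ModuleCat.{u} R}, Y L → ∀ f : N →ₗ[R] L, f = 0) (f : N →ₗ[R] M) : f = 0 := by
  obtain ⟨P⟩ := hM
  let _ := P.instCat
  let _ := P.instFil
  let e := P.iso.toLinearEquiv
  obtain ⟨j, g, hg⟩ := Module.FinitePresentation.exists_factor_of_isColimit R P.isColimit
    (e.symm.toLinearMap ∘ₗ f)
  rw [h (P.mem j) g, LinearMap.comp_zero] at hg
  ext x
  have := LinearMap.congr_fun hg x
  simpa using this.symm

theorem LimClass.hom_eq_zero {X : ModuleCat.{u} R → Prop}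
    {N M : ModuleCat.{u} R} (hN : LimClass R X N)
    (h : ∀ {L : ModuleCat.{u} R}, X L → ∀ f : L →ₗ[R] M, f = 0) (f : N →ₗ[R] M) : f = 0 := by
  obtain ⟨P⟩ := hN
  let _ := P.instCat
  let _ := P.instFil
  ext x
  obtain ⟨j, y, hy⟩ := Concrete.isColimit_exists_rep P.D P.isColimit (P.iso.inv x)
  have := LinearMap.congr_fun
    (h (P.mem j) (f ∘ₗ P.iso.hom.hom ∘ₗ (P.c.ι.app j).hom)) y
  have hx : P.iso.hom (P.c.ι.app j y) = x := by
    rw [hy, ← ConcreteCategory.comp_apply]; simp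
  rw [← hx]
  exact this

theorem LimClass.of_iso {X : ModuleCat.{u} R → Prop} {M N : ModuleCat.{u} R} (e : M ≅ N)
    (h : LimClass R X M) : LimClass R X N := by
  obtain ⟨P⟩ := h
  let _ := P.instCat
  let _ := P.instFil
  exact ⟨⟨P.J, P.D, P.c, P.isColimit, P.mem, P.iso ≪≫ e⟩⟩

theorem LimClass.of_mem {X : ModuleCat.{u} R → Prop} {M : ModuleCat.{u} R} (h : X M) :
    LimClass R X M := by
  let D : Discrete PUnit.{u + 1} ⥤ ModuleCat.{u} R := (Functor.const _).obj M
  let c : Cocone D := { pt := M, ι := 𝟙 _ }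
  have : IsFiltered (Discrete PUnit.{u + 1}) := inferInstance
  obtain ⟨hc⟩ := ModuleCat.nonempty_isColimit_of_filtered R c
    (fun y => ⟨⟨⟨⟩⟩, y, rfl⟩) (fun j x hx => ⟨j, 𝟙 j, hx⟩)
  exact ⟨⟨Discrete PUnit.{u + 1}, D, c, hc, fun _ => h, Iso.refl _⟩⟩

theorem Finsupp.range_lmapDomain_subtype_val {M : Type u} (s : Finset M) :
    LinearMap.range (Finsupp.lmapDomain R R (Subtype.val : s → M)) =
      Finsupp.supported R R (s : Set M) := by
  rw [LinearMap.range_eq_map, ← Finsupp.supported_univ, Finsupp.lmapDomain_supported]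
  simp

section FinitelyPresentedApproximation

variable (M : Type u) [AddCommGroup M] [Module R M]

/-- Finite stages of the tautological presentation of `M`: a finite set of elements together with
a finitely generated module of relations between them. -/
abbrev FiniteRelations : Type u :=
  {p : Finset M × Submodule R (M →₀ R) // p.2.FG ∧ p.2 ≤ Finsupp.supported R R (p.1 : Set M) ∧
    p.2 ≤ LinearMap.ker (Finsupp.linearCombination R (id : M → M))}

variable {R M} in
/-- The finitely presented module given by finitely many generators and relations. -/
abbrev FiniteRelations.toModule (p : FiniteRelations R M) : Type u :=
  (p.1.1 →₀ R) ⧸ p.1.2.comap (Finsupp.lmapDomain R R (Subtype.val : p.1.1 → M))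

instance FiniteRelations.finitePresentation (p : FiniteRelations R M) :
    Module.FinitePresentation R p.toModule := by
  refine Module.finitePresentation_of_surjective (Submodule.mkQ _) (Submodule.mkQ_surjective _) ?_
  rw [Submodule.ker_mkQ]
  refine Submodule.fg_of_fg_map_injective (Finsupp.lmapDomain R R (Subtype.val : p.1.1 → M))
    (Finsupp.mapDomain_injective Subtype.val_injective) ?_
  rw [Submodule.map_comap_eq, Finsupp.range_lmapDomain_subtype_val, inf_eq_right.2 p.2.2.1]
  exact p.2.1

instance FiniteRelations.isDirected : IsDirectedOrder (FiniteRelations R M) where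
  directed p q := by
    classical
    exact ⟨⟨p.1 ⊔ q.1, p.2.1.sup q.2.1,
      sup_le (p.2.2.1.trans (Finsupp.supported_mono (by simp)))
        (q.2.2.1.trans (Finsupp.supported_mono (by simp))),
      sup_le p.2.2.2 q.2.2.2⟩, le_sup_left (a := p.1), le_sup_right (a := p.1)⟩

instance FiniteRelations.nonempty : Nonempty (FiniteRelations R M) :=
  ⟨⟨(∅, ⊥), Submodule.fg_bot, bot_le, bot_le⟩⟩

variable {R M} in
/-- The transition map between two stages. -/
noncomputable def FiniteRelations.transition {p q : FiniteRelations R M} (h : p ≤ q) :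
    p.toModule →ₗ[R] q.toModule :=
  Submodule.mapQ _ _ (Finsupp.lmapDomain R R (Set.inclusion h.1)) (by
    intro x hx
    have hx' : Finsupp.mapDomain Subtype.val x ∈ p.1.2 := hx
    change Finsupp.mapDomain Subtype.val (Finsupp.mapDomain (Set.inclusion h.1) x) ∈ q.1.2
    rw [← Finsupp.mapDomain_comp]
    exact h.2 hx')

/-- The diagram of finitely presented modules approximating `M`. -/
noncomputable def FiniteRelations.diagram : FiniteRelations R M ⥤ ModuleCat.{u} R where
  obj p := ModuleCat.of R p.toModule
  map h := ModuleCat.ofHom (FiniteRelations.transition (leOfHom h))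
  map_id p := by
    refine ModuleCat.hom_ext (LinearMap.ext fun x => ?_)
    obtain ⟨x, rfl⟩ := Submodule.Quotient.mk_surjective _ x
    exact congrArg Submodule.Quotient.mk Finsupp.mapDomain_id
  map_comp f g := by
    refine ModuleCat.hom_ext (LinearMap.ext fun x => ?_)
    obtain ⟨x, rfl⟩ := Submodule.Quotient.mk_surjective _ x
    refine congrArg Submodule.Quotient.mk ?_
    change Finsupp.mapDomain _ x = Finsupp.mapDomain _ (Finsupp.mapDomain _ x)
    rw [← Finsupp.mapDomain_comp]
    rfl

variable {R M} in
/-- The canonical map from a stage to `M`. -/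
noncomputable def FiniteRelations.toTarget (p : FiniteRelations R M) : p.toModule →ₗ[R] M :=
  Submodule.liftQ _ (Finsupp.linearCombination R (id : M → M) ∘ₗ
    Finsupp.lmapDomain R R (Subtype.val : p.1.1 → M)) (fun _ hx => p.2.2.2 hx)

/-- The canonical cocone on `M`. -/
noncomputable def FiniteRelations.cocone : Cocone (FiniteRelations.diagram R M) where
  pt := ModuleCat.of R M
  ι :=
    { app p := ModuleCat.ofHom p.toTarget
      naturality p q h := by
        refine ModuleCat.hom_ext (LinearMap.ext fun x => ?_)
        obtain ⟨x, rfl⟩ := Submodule.Quotient.mk_surjective _ x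
        change Finsupp.linearCombination R (id : M → M) (Finsupp.mapDomain Subtype.val
          (Finsupp.mapDomain (Set.inclusion (leOfHom h).1) x)) =
            Finsupp.linearCombination R (id : M → M) (Finsupp.mapDomain Subtype.val x)
        rw [← Finsupp.mapDomain_comp]
        rfl }

theorem FiniteRelations.nonempty_isColimit :
    Nonempty (IsColimit (FiniteRelations.cocone R M)) := by
  apply ModuleCat.nonempty_isColimit_of_filtered
  · intro m
    refine ⟨⟨({m}, ⊥), Submodule.fg_bot, bot_le, bot_le⟩, Submodule.Quotient.mk
      (Finsupp.single ⟨m, Finset.mem_singleton_self m⟩ 1), ?_⟩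
    change Finsupp.linearCombination R (id : M → M) (Finsupp.mapDomain Subtype.val
      (Finsupp.single _ 1)) = m
    rw [Finsupp.mapDomain_single]
    exact (Finsupp.linearCombination_single R 1 m).trans (one_smul R m)
  · intro p x hx
    obtain ⟨x, rfl⟩ := Submodule.Quotient.mk_surjective _ x
    replace hx : Finsupp.linearCombination R (id : M → M)
      (Finsupp.mapDomain Subtype.val x) = 0 := hx
    have hsupp : Finsupp.mapDomain Subtype.val x ∈ Finsupp.supported R R (p.1.1 : Set M) := by
      rw [← Finsupp.range_lmapDomain_subtype_val]
      exact ⟨x, rfl⟩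
    refine ⟨⟨(p.1.1, p.1.2 ⊔ Submodule.span R {Finsupp.mapDomain Subtype.val x}),
      p.2.1.sup (Submodule.fg_span_singleton _),
      sup_le p.2.2.1 ((Submodule.span_singleton_le_iff_mem _ _).2 hsupp),
      sup_le p.2.2.2 ((Submodule.span_singleton_le_iff_mem _ _).2 hx)⟩,
      homOfLE ⟨le_rfl, le_sup_left⟩, ?_⟩
    refine (Submodule.Quotient.mk_eq_zero _).2 ?_
    change Finsupp.mapDomain Subtype.val (Finsupp.mapDomain (Set.inclusion _) x) ∈
      p.1.2 ⊔ Submodule.span R {Finsupp.mapDomain Subtype.val x}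
    rw [← Finsupp.mapDomain_comp]
    exact le_sup_right (a := p.1.2) (Submodule.mem_span_singleton_self _)

end FinitelyPresentedApproximation

section SubmoduleFamily

variable {R} {J : Type u} [SmallCategory J] {D : J ⥤ ModuleCat.{u} R}

/-- The subdiagram given by a compatible family of submodules. -/
def ModuleCat.subdiagram (t : ∀ j, Submodule R (D.obj j))
    (ht : ∀ {j k : J} (f : j ⟶ k), t j ≤ (t k).comap (D.map f).hom) : J ⥤ ModuleCat.{u} R where
  obj j := ModuleCat.of R (t j)
  map f := ModuleCat.ofHom ((D.map f).hom.restrict (ht f))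
  map_id j := by
    refine ModuleCat.hom_ext (LinearMap.ext fun x => Subtype.ext ?_)
    change D.map (𝟙 j) x.1 = x.1
    simp
  map_comp f g := by
    refine ModuleCat.hom_ext (LinearMap.ext fun x => Subtype.ext ?_)
    change D.map (f ≫ g) x.1 = D.map g (D.map f x.1)
    simp

/-- The diagram of quotients by a compatible family of submodules. -/
def ModuleCat.quotientDiagram (t : ∀ j, Submodule R (D.obj j))
    (ht : ∀ {j k : J} (f : j ⟶ k), t j ≤ (t k).comap (D.map f).hom) : J ⥤ ModuleCat.{u} R where
  obj j := ModuleCat.of R (D.obj j ⧸ t j)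
  map {j k} f := ModuleCat.ofHom ((t j).mapQ (t k) (D.map f).hom (ht f))
  map_id j := by
    refine ModuleCat.hom_ext (LinearMap.ext fun x => ?_)
    obtain ⟨x, rfl⟩ := Submodule.Quotient.mk_surjective _ x
    change Submodule.Quotient.mk (D.map (𝟙 j) x) = Submodule.Quotient.mk x
    simp
  map_comp f g := by
    refine ModuleCat.hom_ext (LinearMap.ext fun x => ?_)
    obtain ⟨x, rfl⟩ := Submodule.Quotient.mk_surjective _ x
    change Submodule.Quotient.mk (D.map (f ≫ g) x) =
      Submodule.Quotient.mk (D.map g (D.map f x))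
    simp

/-- The structure map of a cocone of modules, as a linear map. -/
def ModuleCat.coconeMap (c : Cocone D) (j : J) : D.obj j →ₗ[R] c.pt := (c.ι.app j).hom

theorem ModuleCat.coconeMap_map (c : Cocone D) {j k : J} (f : j ⟶ k) (x : D.obj j) :
    coconeMap c k (D.map f x) = coconeMap c j x := by
  change c.ι.app k (D.map f x) = c.ι.app j x
  rw [← ConcreteCategory.comp_apply, c.w]

/-- The cocone on the subdiagram with a given submodule of the original vertex. -/
def ModuleCat.subcocone (c : Cocone D) (t : ∀ j, Submodule R (D.obj j))
    (ht : ∀ {j k : J} (f : j ⟶ k), t j ≤ (t k).comap (D.map f).hom)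
    (s : Submodule R c.pt) (hs : ∀ j, t j ≤ s.comap (coconeMap c j)) :
    Cocone (subdiagram t ht) where
  pt := ModuleCat.of R s
  ι :=
    { app j := ModuleCat.ofHom ((coconeMap c j).restrict (hs j))
      naturality j k f := by
        refine ModuleCat.hom_ext (LinearMap.ext fun x => Subtype.ext ?_)
        exact coconeMap_map c f x.1 }

/-- The cocone on the diagram of quotients with a given quotient of the original vertex. -/
def ModuleCat.quotientCocone (c : Cocone D) (t : ∀ j, Submodule R (D.obj j))
    (ht : ∀ {j k : J} (f : j ⟶ k), t j ≤ (t k).comap (D.map f).hom)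
    (s : Submodule R c.pt) (hs : ∀ j, t j ≤ s.comap (coconeMap c j)) :
    Cocone (quotientDiagram t ht) where
  pt := ModuleCat.of R (c.pt ⧸ s)
  ι :=
    { app j := ModuleCat.ofHom ((t j).mapQ s (coconeMap c j) (hs j))
      naturality j k f := by
        refine ModuleCat.hom_ext (LinearMap.ext fun x => ?_)
        obtain ⟨x, rfl⟩ := Submodule.Quotient.mk_surjective _ x
        exact congrArg Submodule.Quotient.mk (coconeMap_map c f x) }

theorem ModuleCat.mem_iSup_map_coconeMap [IsFiltered J] (c : Cocone D)
    (t : ∀ j, Submodule R (D.obj j))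
    (ht : ∀ {j k : J} (f : j ⟶ k), t j ≤ (t k).comap (D.map f).hom) {y : c.pt} :
    y ∈ ⨆ j, (t j).map (coconeMap c j) ↔ ∃ j, ∃ x ∈ t j, coconeMap c j x = y := by
  have hmono {j k : J} (f : j ⟶ k) :
      (t j).map (coconeMap c j) ≤ (t k).map (coconeMap c k) := by
    rintro _ ⟨x, hx, rfl⟩
    exact ⟨D.map f x, ht f hx, coconeMap_map c f x⟩
  have := IsFiltered.nonempty (C := J)
  rw [Submodule.mem_iSup_of_directed _ fun j k =>
    ⟨_, hmono (IsFiltered.leftToMax j k), hmono (IsFiltered.rightToMax j k)⟩]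
  simp only [Submodule.mem_map]

/-- A compatible family of submodules of a filtered diagram, with `X`-submodules and
`Y`-quotients, induces such a decomposition of the colimit. -/
theorem exists_limClass_submodule_of_isColimit {X Y : ModuleCat.{u} R → Prop}
    [IsFiltered J] {c : Cocone D} (hc : IsColimit c) (t : ∀ j, Submodule R (D.obj j))
    (ht : ∀ {j k : J} (f : j ⟶ k), t j ≤ (t k).comap (D.map f).hom)
    (hX : ∀ j, X (ModuleCat.of R (t j))) (hY : ∀ j, Y (ModuleCat.of R (D.obj j ⧸ t j))) :
    ∃ s : Submodule R c.pt, LimClass R X (ModuleCat.of R s) ∧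
      LimClass R Y (ModuleCat.of R (c.pt ⧸ s)) := by
  obtain ⟨s, hs⟩ : ∃ s : Submodule R c.pt,
      ∀ y, y ∈ s ↔ ∃ j, ∃ x ∈ t j, ModuleCat.coconeMap c j x = y :=
    ⟨_, fun y => ModuleCat.mem_iSup_map_coconeMap c t ht⟩
  have hle (j : J) : t j ≤ s.comap (ModuleCat.coconeMap c j) :=
    fun x hx => (hs _).2 ⟨j, x, hx, rfl⟩
  obtain ⟨hsub⟩ : Nonempty (IsColimit (ModuleCat.subcocone c t ht s hle)) := by
    apply ModuleCat.nonempty_isColimit_of_filtered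
    · rintro ⟨y, hy⟩
      obtain ⟨j, x, hx, h⟩ := (hs y).1 hy
      exact ⟨j, ⟨x, hx⟩, Subtype.ext h⟩
    · intro j x hx
      obtain ⟨k, f, hf⟩ := ModuleCat.exists_map_eq_zero_of_isColimit R hc j x.1
        (congrArg Subtype.val hx)
      exact ⟨k, f, Subtype.ext hf⟩
  obtain ⟨hquot⟩ : Nonempty (IsColimit (ModuleCat.quotientCocone c t ht s hle)) := by
    apply ModuleCat.nonempty_isColimit_of_filtered
    · intro y
      obtain ⟨y, rfl⟩ := Submodule.Quotient.mk_surjective _ y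
      obtain ⟨j, x, rfl⟩ := Concrete.isColimit_exists_rep D hc y
      exact ⟨j, Submodule.Quotient.mk x, rfl⟩
    · intro j x hx
      obtain ⟨x, rfl⟩ := Submodule.Quotient.mk_surjective _ x
      obtain ⟨k, y, hy, h⟩ := (hs _).1 ((Submodule.Quotient.mk_eq_zero s).1 hx)
      obtain ⟨l, f, g, hfg⟩ := Concrete.isColimit_exists_of_rep_eq D hc y x h
      refine ⟨l, g, (Submodule.Quotient.mk_eq_zero (t l)).2 ?_⟩
      change D.map g x ∈ t l
      rw [← hfg]
      exact ht f hy
  exact ⟨s, ⟨⟨J, _, _, hsub, hX, Iso.refl _⟩⟩, ⟨⟨J, _, _, hquot, hY, Iso.refl _⟩⟩⟩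

end SubmoduleFamily

theorem FpTorsionPair.exists_limClass_submodule {X Y : ModuleCat.{u} R → Prop}
    (hfp : FpTorsionPair R X Y) (M : ModuleCat.{u} R) :
    ∃ s : Submodule R M, LimClass R X (ModuleCat.of R s) ∧
      LimClass R Y (ModuleCat.of R (M ⧸ s)) := by
  obtain ⟨hc⟩ := FiniteRelations.nonempty_isColimit R M
  choose t hX hY using fun p : FiniteRelations R M =>
    hfp.exists_torsion_submodule ((FiniteRelations.diagram R M).obj p)
      (FiniteRelations.finitePresentation R M p)
  refine exists_limClass_submodule_of_isColimit hc t (fun {p q} f x hx => ?_) hX hY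
  have := LinearMap.congr_fun (hfp.hom_eq_zero (hX p) (hY q)
    ((t q).mkQ ∘ₗ ((FiniteRelations.diagram R M).map f).hom ∘ₗ (t p).subtype)) ⟨x, hx⟩
  exact (Submodule.Quotient.mk_eq_zero (t q)).1 this

theorem FpTorsionPair.limClass_right_iff {X Y : ModuleCat.{u} R → Prop}
    (hfp : FpTorsionPair R X Y) (M : ModuleCat.{u} R) :
    LimClass R Y M ↔ ∀ N : ModuleCat.{u} R, X N → ∀ f : N →ₗ[R] M, f = 0 := by
  constructor
  · intro hM N hN f
    have := hfp.fp_left N hN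
    exact hM.hom_eq_zero_of_finitePresentation R (fun hL g => hfp.hom_eq_zero hN hL g) f
  · intro h
    obtain ⟨s, hs, hq⟩ := hfp.exists_limClass_submodule R M
    have h0 : s.subtype = 0 := hs.hom_eq_zero R (fun hL g => h _ hL g) s.subtype
    have hbot : s = ⊥ := by
      rw [← s.range_subtype, h0, LinearMap.range_zero]
    exact hq.of_iso R (s.quotEquivOfEqBot hbot).toModuleIso

/-- **Theorem.** Over a left coherent ring, the direct-limit closures of the two classes
of a torsion pair in `fp(R-Mod)` form a tCG torsion pair in `R`-Mod; in particular
`lim→ Y` consists exactly of the modules receiving no nonzero map from any member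
of `X`. -/
theorem coherent_limClass_tCG (hcoh : LeftCoherent R)
    (X Y : ModuleCat.{u} R → Prop) (hfp : FpTorsionPair R X Y) :
    ModTorsionPair R (LimClass R X) (LimClass R Y) ∧
    IsTCGTorsionPair R (LimClass R X) (LimClass R Y) ∧
    ∀ M : ModuleCat.{u} R,
      LimClass R Y M ↔ ∀ (N : ModuleCat.{u} R), X N → ∀ f : N →ₗ[R] M, f = 0 := by
  refine ⟨⟨fun e h => h.of_iso R e, fun e h => h.of_iso R e, ?_,
    hfp.exists_limClass_submodule R⟩, ?_, hfp.limClass_right_iff R⟩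
  · intro M N hM hN f
    exact hM.hom_eq_zero R (fun hL g => (hfp.limClass_right_iff R N).1 hN _ hL g) f
  · refine ⟨{p : Σ n : ℕ, Submodule R (Fin n → R) // X (ModuleCat.of R ((Fin p.1 → R) ⧸ p.2))},
      fun p => ModuleCat.of R ((Fin p.1.1 → R) ⧸ p.1.2), fun p => hfp.fp_left _ p.2,
      fun p => .of_mem R p.2, fun M => ?_⟩
    rw [hfp.limClass_right_iff R M]
    refine ⟨fun h p f => h _ p.2 f, fun h N hN f => ?_⟩
    have := hfp.fp_left N hN
    obtain ⟨n, π, hπ⟩ := Module.Finite.exists_fin' R N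
    let e := π.quotKerEquivOfSurjective hπ
    have hf := h ⟨⟨n, LinearMap.ker π⟩, hfp.iso_closed_left e.symm.toModuleIso hN⟩
      (f ∘ₗ e.toLinearMap)
    ext x
    simpa using LinearMap.congr_fun hf (e.symm x)
end

section
/- Let R be a left Noetherian ring and let (𝒯,ℱ) be a tCG torsion pair in R-Mod. Then the pair (𝒯 ∩ fp(R-Mod), ℱ ∩ fp(R-Mod)) is a torsion pair in fp(R-Mod), and moreover lim→(𝒯 ∩ fp(R-Mod)) = 𝒯 and lim→(ℱ ∩ fp(R-Mod)) = ℱ. In particular, over a left Noetherian ring the assignment (𝒳,𝒴) ↦ (lim→𝒳, lim→𝒴) from torsion pairs in fp(R-Mod) to tCG torsion pairs in R-Mod is bijective. -/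
open CategoryTheory Limits DirectSum

universe w u

variable (R : Type u) [Ring R]

variable {R}

lemma LinearMap.exists_comp_eq_of_ker_le {A B C : Type*} [AddCommGroup A] [Module R A]
    [AddCommGroup B] [Module R B] [AddCommGroup C] [Module R C] (g : A →ₗ[R] B)
    (hg : Function.Surjective g) (f : A →ₗ[R] C) (hker : g.ker ≤ f.ker) :
    ∃ h : B →ₗ[R] C, h ∘ₗ g = f := by
  refine ⟨(LinearMap.ker g).liftQ f hker ∘ₗ (g.quotKerEquivOfSurjective hg).symm.toLinearMap, ?_⟩
  ext x
  have : (g.quotKerEquivOfSurjective hg).symm (g x) = Submodule.Quotient.mk x := by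
    rw [LinearEquiv.symm_apply_eq]; rfl
  simp [this]

lemma Submodule.FG.exists_fg_map_eq {A B : Type*} [AddCommGroup A] [Module R A]
    [AddCommGroup B] [Module R B] {V : Submodule R B} (hV : V.FG) {g : A →ₗ[R] B}
    (hg : Function.Surjective g) : ∃ N : Submodule R A, N.FG ∧ N.map g = V := by
  induction V, hV using Submodule.fg_induction with
  | singleton x =>
    obtain ⟨y, rfl⟩ := hg x
    exact ⟨R ∙ y, Submodule.fg_span_singleton y, by rw [Submodule.map_span, Set.image_singleton]⟩
  | sup V₁ V₂ h₁ h₂ ih₁ ih₂ =>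
    obtain ⟨N₁, hN₁, rfl⟩ := ih₁
    obtain ⟨N₂, hN₂, rfl⟩ := ih₂
    exact ⟨N₁ ⊔ N₂, hN₁.sup hN₂, Submodule.map_sup _ _ _⟩

namespace ModTorsionPair

variable {T F : ModuleCat.{u} R → Prop} (htp : ModTorsionPair R T F)
include htp

lemma torsion_iff (M : ModuleCat.{u} R) :
    T M ↔ ∀ N : ModuleCat.{u} R, F N → ∀ f : M →ₗ[R] N, f = 0 := by
  refine ⟨fun h N hN f => htp.hom_eq_zero h hN f, fun h => ?_⟩
  obtain ⟨t, ht, hq⟩ := htp.exists_torsion_submodule M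
  have h0 : t = ⊤ := by rw [← t.ker_mkQ, h _ hq t.mkQ, LinearMap.ker_zero]
  subst h0
  exact htp.iso_closed_torsion (Submodule.topEquiv (R := R) (M := M)).toModuleIso ht

lemma torsion_of_surjective {M N : ModuleCat.{u} R} (hM : T M) (g : M →ₗ[R] N)
    (hg : Function.Surjective g) : T N := by
  rw [htp.torsion_iff]
  intro G hG f
  have := htp.hom_eq_zero hM hG (f ∘ₗ g)
  exact LinearMap.ext fun x => by
    obtain ⟨y, rfl⟩ := hg x
    exact LinearMap.congr_fun this y

lemma eq_zero_of_ker_le {A : Type*} [AddCommGroup A] [Module R A] {B C : ModuleCat.{u} R}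
    (hB : T B) (hC : F C) (g : A →ₗ[R] B) (hg : Function.Surjective g) (f : A →ₗ[R] C)
    (hker : g.ker ≤ f.ker) : f = 0 := by
  obtain ⟨h, rfl⟩ := g.exists_comp_eq_of_ker_le hg f hker
  rw [htp.hom_eq_zero hB hC h, LinearMap.zero_comp]

lemma torsion_sup {M : ModuleCat.{u} R} {A B : Submodule R M}
    (h : ∀ G : ModuleCat.{u} R, F G → ∀ f : ↥(A ⊔ B) →ₗ[R] G,
      f ∘ₗ Submodule.inclusion le_sup_left = 0 ∧ f ∘ₗ Submodule.inclusion le_sup_right = 0) :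
    T (ModuleCat.of R ↥(A ⊔ B)) := by
  rw [htp.torsion_iff]
  intro G hG f
  obtain ⟨h1, h2⟩ := h G hG f
  refine LinearMap.ext fun x => ?_
  obtain ⟨x, hx⟩ := x
  obtain ⟨a, ha, b, hb, rfl⟩ := Submodule.mem_sup.1 hx
  have e1 : f ⟨a, le_sup_left (a := A) (b := B) ha⟩ = 0 := LinearMap.congr_fun h1 ⟨a, ha⟩
  have e2 : f ⟨b, le_sup_right (a := A) (b := B) hb⟩ = 0 := LinearMap.congr_fun h2 ⟨b, hb⟩
  have := f.map_add ⟨a, le_sup_left (a := A) (b := B) ha⟩ ⟨b, le_sup_right (a := A) (b := B) hb⟩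
  rw [e1, e2, add_zero] at this
  exact this

/-- Torsion classes are closed under direct limits. -/
lemma torsion_of_limClass {X : ModuleCat.{u} R → Prop} (hX : ∀ M, X M → T M)
    {M : ModuleCat.{u} R} (h : LimClass R X M) : T M := by
  obtain ⟨J, D, c, hc, hmem, e⟩ := h
  refine htp.iso_closed_torsion e ((htp.torsion_iff _).2 fun G hG f => ?_)
  have : ModuleCat.ofHom f = 0 := hc.hom_ext fun j => by
    ext1
    simpa using htp.hom_eq_zero (hX _ (hmem j)) hG (f ∘ₗ (c.ι.app j).hom)
  exact congrArg ModuleCat.Hom.hom this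

end ModTorsionPair

/-- A module is the direct limit of the members of a directed cover by submodules. -/
lemma limClass_of_directedOn {X : ModuleCat.{u} R → Prop} {M : ModuleCat.{u} R}
    (S : Set (Submodule R M)) (hdir : DirectedOn (· ≤ ·) S)
    (hcover : ∀ m : M, ∃ N ∈ S, m ∈ N) (hX : ∀ N ∈ S, X (ModuleCat.of R N)) :
    LimClass R X M := by
  have : Nonempty S := let ⟨N, hN, _⟩ := hcover 0; ⟨⟨N, hN⟩⟩
  have : IsDirected S (· ≤ ·) := directedOn_iff_isDirectedOrder.1 hdir
  let D : S ⥤ ModuleCat.{u} R :=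
    { obj := fun N => ModuleCat.of R N.1
      map := fun f => ModuleCat.ofHom (Submodule.inclusion (leOfHom f)) }
  let c : Cocone D :=
    { pt := M
      ι := { app := fun N => ModuleCat.ofHom N.1.subtype } }
  have hc : IsColimit c := by
    refine isColimitOfReflects (forget (ModuleCat.{u} R))
      (Types.FilteredColimit.isColimitOf' _ _ ?_ ?_)
    · intro m
      obtain ⟨N, hN, hm⟩ := hcover m
      exact ⟨⟨N, hN⟩, ⟨m, hm⟩, rfl⟩
    · intro i x y hxy
      exact ⟨i, 𝟙 i, by rw [show x = y from Subtype.ext hxy]⟩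
  exact ⟨{ J := S, D := D, c := c, isColimit := hc, mem := fun N => hX _ N.2, iso := Iso.refl _ }⟩

lemma limClass_of_mem {X : ModuleCat.{u} R → Prop}
    (hiso : ∀ {M N : ModuleCat.{u} R}, (M ≅ N) → X M → X N) {M : ModuleCat.{u} R} (hM : X M) :
    LimClass R X M :=
  limClass_of_directedOn {⊤} (directedOn_singleton _) (fun _ => ⟨⊤, rfl, trivial⟩) (by
    rintro _ rfl
    exact hiso (Submodule.topEquiv (R := R) (M := M)).symm.toModuleIso hM)

section FilteredColimit

variable {J : Type u} [SmallCategory J] [IsFiltered J] {D : J ⥤ ModuleCat.{u} R} {c : Cocone D}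
  (hc : IsColimit c)
include hc

lemma exists_fg_map_eq_of_isColimit {V : Submodule R c.pt} (hV : V.FG) :
    ∃ (j : J) (N : Submodule R (D.obj j)), N.FG ∧ N.map (c.ι.app j).hom = V := by
  induction V, hV using Submodule.fg_induction with
  | singleton x =>
    obtain ⟨j, y, rfl⟩ : ∃ j, ∃ y : D.obj j, c.ι.app j y = x :=
      Types.jointly_surjective (D ⋙ forget _) (isColimitOfPreserves (forget _) hc) x
    exact ⟨j, R ∙ y, Submodule.fg_span_singleton y, by
      rw [Submodule.map_span, Set.image_singleton]⟩
  | sup V₁ V₂ h₁ h₂ ih₁ ih₂ =>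
    obtain ⟨j₁, N₁, hN₁, rfl⟩ := ih₁
    obtain ⟨j₂, N₂, hN₂, rfl⟩ := ih₂
    refine ⟨IsFiltered.max j₁ j₂, N₁.map (D.map (IsFiltered.leftToMax j₁ j₂)).hom ⊔
      N₂.map (D.map (IsFiltered.rightToMax j₁ j₂)).hom, (hN₁.map _).sup (hN₂.map _), ?_⟩
    rw [Submodule.map_sup, ← Submodule.map_comp, ← Submodule.map_comp, ← ModuleCat.hom_comp,
      ← ModuleCat.hom_comp, c.w, c.w]

lemma exists_le_ker_map_of_isColimit {j : J} {K : Submodule R (D.obj j)} (hK : K.FG)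
    (hle : K ≤ (c.ι.app j).hom.ker) : ∃ (k : J) (f : j ⟶ k), K ≤ (D.map f).hom.ker := by
  induction K, hK using Submodule.fg_induction with
  | singleton x =>
    have hx : (c.ι.app j).hom x = (c.ι.app j).hom 0 := by
      rw [map_zero]; exact hle (Submodule.mem_span_singleton_self x)
    obtain ⟨k, f, hf⟩ := (Types.FilteredColimit.isColimit_eq_iff'
      (isColimitOfPreserves (forget _) hc) (i := j) x 0).1 hx
    refine ⟨k, f, ?_⟩
    rw [Submodule.span_singleton_le_iff_mem, LinearMap.mem_ker]
    exact hf.trans (map_zero (D.map f).hom)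
  | sup K₁ K₂ h₁ h₂ ih₁ ih₂ =>
    obtain ⟨k₁, f₁, hf₁⟩ := ih₁ (le_sup_left.trans hle)
    obtain ⟨k₂, f₂, hf₂⟩ := ih₂ (le_sup_right.trans hle)
    obtain ⟨k, g₁, g₂, hg⟩ := IsFilteredOrEmpty.cocone_objs k₁ k₂
    let a := IsFiltered.coeqHom (f₁ ≫ g₁) (f₂ ≫ g₂)
    refine ⟨_, (f₁ ≫ g₁) ≫ a, sup_le ?_ ?_⟩
    · intro x hx
      have := hf₁ hx
      simp_all
    · rw [IsFiltered.coeq_condition]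
      intro x hx
      have := hf₂ hx
      simp_all

end FilteredColimit

namespace IsTCGTorsionPair

variable {T F : ModuleCat.{u} R → Prop}

lemma torsionfree_of_injective (htcg : IsTCGTorsionPair R T F) {M N : ModuleCat.{u} R} (hN : F N)
    (g : M →ₗ[R] N) (hg : Function.Injective g) : F M := by
  obtain ⟨Λ, P, -, -, h⟩ := htcg
  refine (h M).2 fun l f => LinearMap.ext fun x => hg ?_
  simpa using LinearMap.congr_fun ((h N).1 hN l (g ∘ₗ f)) x

lemma limClass_of_torsionfree [IsNoetherianRing R] (htcg : IsTCGTorsionPair R T F)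
    {M : ModuleCat.{u} R} (hM : F M) :
    LimClass R (fun N => F N ∧ Module.FinitePresentation R N) M := by
  refine limClass_of_directedOn {N | N.FG} ?_ ?_ ?_
  · exact fun A hA B hB => ⟨A ⊔ B, hA.sup hB, le_sup_left, le_sup_right⟩
  · exact fun m => ⟨R ∙ m, Submodule.fg_span_singleton m, Submodule.mem_span_singleton_self m⟩
  · intro N hN
    have : Module.Finite R N := Module.Finite.iff_fg.2 hN
    exact ⟨htcg.torsionfree_of_injective hM (M := ModuleCat.of R N) N.subtype
      N.injective_subtype, Module.finitePresentation_of_finite R N⟩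

variable (htp : ModTorsionPair R T F) (htcg : IsTCGTorsionPair R T F)
include htp htcg

lemma torsionfree_of_fg (M : ModuleCat.{u} R)
    (h : ∀ V : Submodule R M, V.FG → T (ModuleCat.of R V) → V = ⊥) : F M := by
  obtain ⟨Λ, P, hfp, hT, hF⟩ := htcg
  refine (hF M).2 fun l f => LinearMap.range_eq_bot.1 (h _ ?_ ?_)
  · have := hfp l
    exact LinearMap.range_eq_map f ▸ (Module.Finite.fg_top (R := R) (M := P l)).map f
  · exact htp.torsion_of_surjective (hT l) (N := ModuleCat.of R f.range) f.rangeRestrict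
      f.surjective_rangeRestrict

/-- The torsion-free class of a tCG torsion pair is closed under direct limits. -/
lemma torsionfree_of_limClass [IsNoetherianRing R] {X : ModuleCat.{u} R → Prop}
    (hX : ∀ M, X M → F M)
    {M : ModuleCat.{u} R} (h : LimClass R X M) : F M := by
  obtain ⟨J, D, c, hc, hmem, e⟩ := h
  refine htp.iso_closed_torsionfree e (htcg.torsionfree_of_fg htp _ fun V hV hVT => ?_)
  obtain ⟨j, N, hN, rfl⟩ := exists_fg_map_eq_of_isColimit hc hV
  obtain ⟨k, f, hf⟩ := exists_le_ker_map_of_isColimit hc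
    (hN.of_le (inf_le_left (b := (c.ι.app j).hom.ker))) inf_le_right
  have h0 := htp.eq_zero_of_ker_le hVT (hX _ (hmem k)) ((c.ι.app j).hom.submoduleMap N)
    ((c.ι.app j).hom.submoduleMap_surjective N) ((D.map f).hom ∘ₗ N.subtype) (by
      intro x hx
      exact hf ⟨x.2, congrArg Subtype.val (LinearMap.mem_ker.1 hx)⟩)
  rw [← LinearMap.le_ker_iff_map]
  intro x hx
  have h1 : (D.map f).hom x = 0 := LinearMap.congr_fun h0 ⟨x, hx⟩
  rw [LinearMap.mem_ker, ← c.w f, ModuleCat.hom_comp, LinearMap.comp_apply, h1, map_zero]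

lemma limClass_of_torsion [IsNoetherianRing R] {M : ModuleCat.{u} R} (hM : T M) :
    LimClass R (fun N => T N ∧ Module.FinitePresentation R N) M := by
  let S : Set (Submodule R M) := {N | N.FG ∧ T (ModuleCat.of R N)}
  have hdir : DirectedOn (· ≤ ·) S := fun A hA B hB =>
    ⟨A ⊔ B, ⟨hA.1.sup hB.1, htp.torsion_sup fun G hG f =>
      ⟨htp.hom_eq_zero hA.2 hG _, htp.hom_eq_zero hB.2 hG _⟩⟩, le_sup_left, le_sup_right⟩
  have hne : S.Nonempty := ⟨⊥, Submodule.fg_bot, (htp.torsion_iff _).2 fun G _ f =>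
    LinearMap.ext fun x => by
      rw [Subsingleton.elim (α := (⊥ : Submodule R M)) x 0, map_zero, map_zero]⟩
  have hquot : F (ModuleCat.of R (M ⧸ sSup S)) := by
    refine htcg.torsionfree_of_fg htp _ fun V hV hVT => ?_
    obtain ⟨N, hN, rfl⟩ := hV.exists_fg_map_eq (sSup S).mkQ_surjective
    have hK : (N ⊓ sSup S).FG := hN.of_le inf_le_left
    obtain ⟨A, hA, hle⟩ : ∃ A ∈ S, N ⊓ sSup S ≤ A :=
      (CompleteLattice.isCompactElement_iff_le_of_directed_sSup_le _ _).1
        ((Submodule.fg_iff_compact _).1 hK) S hne hdir inf_le_right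
    have hNA : N ⊔ A ∈ S := by
      refine ⟨hN.sup hA.1, htp.torsion_sup fun G hG f => ?_⟩
      have hA0 := htp.hom_eq_zero hA.2 hG (f ∘ₗ Submodule.inclusion le_sup_right)
      refine ⟨htp.eq_zero_of_ker_le hVT hG ((sSup S).mkQ.submoduleMap N)
        ((sSup S).mkQ.submoduleMap_surjective N) _ fun x hx => ?_, hA0⟩
      have hxS : (x : M) ∈ sSup S := by
        rw [← (sSup S).ker_mkQ]
        exact congrArg Subtype.val (LinearMap.mem_ker.1 hx)
      exact LinearMap.congr_fun hA0 ⟨x, hle ⟨x.2, hxS⟩⟩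
    rw [← LinearMap.le_ker_iff_map, Submodule.ker_mkQ]
    exact le_sup_left.trans (le_sSup hNA)
  have htop : sSup S = ⊤ := by
    rw [← (sSup S).ker_mkQ, htp.hom_eq_zero hM hquot (sSup S).mkQ, LinearMap.ker_zero]
  refine limClass_of_directedOn S hdir (fun m => ?_) fun N hN => ?_
  · exact (Submodule.mem_sSup_of_directed hne hdir).1 (htop ▸ Submodule.mem_top)
  · have : Module.Finite R N := Module.Finite.iff_fg.2 hN.1
    exact ⟨hN.2, Module.finitePresentation_of_finite R N⟩

end IsTCGTorsionPair

/-- Over a left Noetherian ring, every torsion pair restricts to finitely presented modules. -/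
lemma ModTorsionPair.fpTorsionPair [IsNoetherianRing R] {T F : ModuleCat.{u} R → Prop}
    (htp : ModTorsionPair R T F) :
    FpTorsionPair R (fun M => T M ∧ Module.FinitePresentation R M)
    (fun M => F M ∧ Module.FinitePresentation R M) where
  fp_left _ h := h.2
  fp_right _ h := h.2
  iso_closed_left e h := ⟨htp.iso_closed_torsion e h.1,
    have := h.2; Module.FinitePresentation.of_equiv e.toLinearEquiv⟩
  iso_closed_right e h := ⟨htp.iso_closed_torsionfree e h.1,
    have := h.2; Module.FinitePresentation.of_equiv e.toLinearEquiv⟩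
  hom_eq_zero hM hN := htp.hom_eq_zero hM.1 hN.1
  exists_torsion_submodule M hM := by
    obtain ⟨t, ht, hq⟩ := htp.exists_torsion_submodule M
    have : IsNoetherian R M := isNoetherian_of_isNoetherianRing_of_finite R M
    exact ⟨t, ⟨ht, Module.finitePresentation_of_finite R t⟩, hq,
      Module.finitePresentation_of_finite R (M ⧸ t)⟩

namespace FpTorsionPair

variable {X Y : ModuleCat.{u} R → Prop} (h : FpTorsionPair R X Y)
include h

lemma left_of_hom_eq_zero {M : ModuleCat.{u} R} [Module.FinitePresentation R M]
    (hM : ∀ N : ModuleCat.{u} R, Y N → ∀ f : M →ₗ[R] N, f = 0) : X M := by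
  obtain ⟨t, ht, hq⟩ := h.exists_torsion_submodule M ‹_›
  have h0 : t = ⊤ := by rw [← t.ker_mkQ, hM _ hq t.mkQ, LinearMap.ker_zero]
  subst h0
  exact h.iso_closed_left (Submodule.topEquiv (R := R) (M := M)).toModuleIso ht

lemma right_of_hom_eq_zero {M : ModuleCat.{u} R} [Module.FinitePresentation R M]
    (hM : ∀ N : ModuleCat.{u} R, X N → ∀ f : N →ₗ[R] M, f = 0) : Y M := by
  obtain ⟨t, ht, hq⟩ := h.exists_torsion_submodule M ‹_›
  have h0 : t = ⊥ := by rw [← t.range_subtype, hM _ ht t.subtype, LinearMap.range_zero]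
  exact h.iso_closed_right (t.quotEquivOfEqBot h0).toModuleIso hq

end FpTorsionPair

variable (R)

/-- **Theorem.** Over a left Noetherian ring, every tCG torsion pair `(T, F)` restricts
to a torsion pair in `fp(R-Mod)` whose classes have direct-limit closures `T` and `F`;
in particular, `(X, Y) ↦ (lim→ X, lim→ Y)` is a bijection from torsion pairs in
`fp(R-Mod)` onto tCG torsion pairs. -/
theorem noetherian_tCG_restricts_to_fp [IsNoetherianRing R]
    (T F : ModuleCat.{u} R → Prop) (htp : ModTorsionPair R T F)
    (htcg : IsTCGTorsionPair R T F) :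
    FpTorsionPair R (fun M => T M ∧ Module.FinitePresentation R M)
      (fun M => F M ∧ Module.FinitePresentation R M) ∧
    (∀ M : ModuleCat.{u} R,
      LimClass R (fun N => T N ∧ Module.FinitePresentation R N) M ↔ T M) ∧
    (∀ M : ModuleCat.{u} R,
      LimClass R (fun N => F N ∧ Module.FinitePresentation R N) M ↔ F M) ∧
    (∃! XY : (ModuleCat.{u} R → Prop) × (ModuleCat.{u} R → Prop),
      FpTorsionPair R XY.1 XY.2 ∧ (∀ M, LimClass R XY.1 M ↔ T M) ∧
        (∀ M, LimClass R XY.2 M ↔ F M)) := by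
  have hT : ∀ M : ModuleCat.{u} R,
      LimClass R (fun N => T N ∧ Module.FinitePresentation R N) M ↔ T M := fun M =>
    ⟨htp.torsion_of_limClass fun _ h => h.1, htcg.limClass_of_torsion htp⟩
  have hF : ∀ M : ModuleCat.{u} R,
      LimClass R (fun N => F N ∧ Module.FinitePresentation R N) M ↔ F M := fun M =>
    ⟨htcg.torsionfree_of_limClass htp fun _ h => h.1, htcg.limClass_of_torsionfree⟩
  have hfp := htp.fpTorsionPair
  refine ⟨hfp, hT, hF, ⟨_, _⟩, ⟨hfp, hT, hF⟩, ?_⟩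
  rintro ⟨X, Y⟩ ⟨h, hX, hY⟩
  have hXT : ∀ M, X M → T M := fun M hM => (hX M).1 (limClass_of_mem h.iso_closed_left hM)
  have hYF : ∀ M, Y M → F M := fun M hM => (hY M).1 (limClass_of_mem h.iso_closed_right hM)
  refine Prod.ext (funext fun M => propext ⟨fun hM => ⟨hXT M hM, h.fp_left M hM⟩, ?_⟩)
    (funext fun M => propext ⟨fun hM => ⟨hYF M hM, h.fp_right M hM⟩, ?_⟩)
  · rintro ⟨hM, _⟩
    exact h.left_of_hom_eq_zero fun N hN => htp.hom_eq_zero hM (hYF N hN)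
  · rintro ⟨hM, _⟩
    exact h.right_of_hom_eq_zero fun N hN => htp.hom_eq_zero (hXT N hN) hM
end

section
/- Let R = ∏_{n∈ℕ} ℤ/2ℤ with componentwise addition and multiplication, and let 𝔞 = ⊕_{n∈ℕ} ℤ/2ℤ be the ideal of finitely supported elements; 𝔞 is a two-sided idempotent ideal of R. For each n ∈ ℕ let I_n = {x ∈ R : x_k = 0 for all k > n} be the submodule of elements supported in the first n coordinates. Then each I_n is a finitely presented R-module with 𝔞I_n = I_n (so I_n ∈ C_𝔞), and T_𝔞 = {M ∈ R-Mod : Hom_R(I_n, M) = 0 for all n ∈ ℕ}; consequently the torsion pair (C_𝔞, T_𝔞) is a tCG torsion pair. -/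
open CategoryTheory Limits DirectSum

universe w u

variable (R : Type u) [Ring R]

/-- The ring `∏_{n ∈ ℕ} ℤ/2ℤ` with componentwise addition and multiplication. -/
abbrev RProd : Type := ℕ → ZMod 2

/-- The two-sided idempotent ideal `⊕_{n ∈ ℕ} ℤ/2ℤ` of finitely supported elements. -/
def frakA : Submodule RProd RProd where
  carrier := {x | (Function.support x).Finite}
  add_mem' := fun hx hy => ((hx.union hy)).subset (Function.support_add _ _)
  zero_mem' := by simp
  smul_mem' := by
    intro c x hx
    apply hx.subset
    intro n hn
    simp only [Function.mem_support] at hn ⊢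
    intro h
    exact hn (by rw [smul_eq_mul, Pi.mul_apply, h, mul_zero])

/-- The submodule `I_n = {x : x k = 0 for all k > n}` of elements supported in the
first coordinates. -/
def In (n : ℕ) : Submodule RProd RProd where
  carrier := {x | ∀ k, n < k → x k = 0}
  add_mem' := fun hx hy k hk => by
    rw [Pi.add_apply, hx k hk, hy k hk, add_zero]
  zero_mem' := fun k _ => rfl
  smul_mem' := fun c x hx k hk => by
    rw [smul_eq_mul, Pi.mul_apply, hx k hk, mul_zero]

/-- The submodule `𝔞M` of `M`, for a left ideal `𝔞` of `R`. -/
def idealSMul (a : Submodule R R) (M : ModuleCat.{u} R) : Submodule R M :=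
  Submodule.span R {x : M | ∃ r ∈ a, ∃ m : M, x = r • m}

/-- `a` is a two-sided idempotent ideal of `R`: a left ideal closed under right
multiplication which satisfies `a * a = a`. -/
structure IsIdempotentTwoSidedIdeal (a : Submodule R R) : Prop where
  mul_mem_right : ∀ x ∈ a, ∀ r : R, x * r ∈ a
  idem : Submodule.span R {x : R | ∃ b ∈ a, ∃ c ∈ a, x = b * c} = a

/-- The class `C_𝔞 = {M : 𝔞M = M}`. -/
def CClass (a : Submodule R R) : ModuleCat.{u} R → Prop :=
  fun M => idealSMul R a M = ⊤

/-- The class `T_𝔞 = {M : 𝔞M = 0}`. -/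
def TClass (a : Submodule R R) : ModuleCat.{u} R → Prop :=
  fun M => ∀ r ∈ a, ∀ m : M, r • m = (0 : M)

/-- The idempotent `∑_{k ≤ n} e_k` that generates `I_n`. -/
def truncIdem (n : ℕ) : RProd := fun k => if k ≤ n then 1 else 0

lemma truncIdem_mul_mem_In (n : ℕ) (x : RProd) : x * truncIdem n ∈ In n := by
  intro k hk
  simp [truncIdem, Nat.not_le.mpr hk]

lemma truncIdem_mul_of_mem_In {n : ℕ} {x : RProd} (hx : x ∈ In n) : truncIdem n * x = x := by
  funext k
  by_cases hk : k ≤ n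
  · simp [truncIdem, hk]
  · simp [hx k (Nat.lt_of_not_le hk)]

lemma truncIdem_smul_In {n : ℕ} (x : In n) : truncIdem n • x = x :=
  Subtype.ext (truncIdem_mul_of_mem_In x.2)

lemma mem_frakA_of_mem_In {n : ℕ} {x : RProd} (hx : x ∈ In n) : x ∈ frakA := by
  refine (Set.finite_Iic n).subset fun k hk => ?_
  by_contra hkn
  exact hk (hx k (Nat.lt_of_not_le hkn))

lemma exists_mem_In_of_mem_frakA {x : RProd} (hx : x ∈ frakA) : ∃ n, x ∈ In n := by
  obtain ⟨n, hn⟩ := Set.Finite.bddAbove (s := Function.support x) hx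
  refine ⟨n, fun k hk => ?_⟩
  by_contra h
  exact absurd (hn h) (Nat.not_le.mpr hk)

lemma truncIdem_mem_frakA (n : ℕ) : truncIdem n ∈ frakA :=
  mem_frakA_of_mem_In (n := n) (by simpa using truncIdem_mul_mem_In n 1)

/-- Multiplication by `truncIdem n`, a retraction of the ring onto `I_n`. -/
def truncProj (n : ℕ) : RProd →ₗ[RProd] In n :=
  (LinearMap.toSpanSingleton RProd RProd (truncIdem n)).codRestrict (In n)
    (truncIdem_mul_mem_In n)

lemma truncProj_comp_subtype (n : ℕ) : truncProj n ∘ₗ (In n).subtype = LinearMap.id := by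
  ext1 x
  refine Subtype.ext ?_
  change (x : RProd) * truncIdem n = x
  rw [mul_comm, truncIdem_mul_of_mem_In x.2]

lemma finitePresentation_In (n : ℕ) : Module.FinitePresentation RProd (In n) := by
  have : Module.Projective RProd (In n) :=
    Module.Projective.of_split (In n).subtype (truncProj n) (truncProj_comp_subtype n)
  have : Module.Finite RProd (In n) :=
    Module.Finite.of_surjective (truncProj n) fun x =>
      ⟨x, LinearMap.congr_fun (truncProj_comp_subtype n) x⟩
  exact Module.finitePresentation_of_projective RProd (In n)

lemma isIdempotentTwoSidedIdeal_frakA : IsIdempotentTwoSidedIdeal RProd frakA where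
  mul_mem_right x hx r := by
    rw [mul_comm]
    exact frakA.smul_mem r hx
  idem := by
    apply le_antisymm
    · rw [Submodule.span_le]
      rintro _ ⟨b, -, c, hc, rfl⟩
      exact frakA.smul_mem b hc
    · intro x hx
      obtain ⟨n, hn⟩ := exists_mem_In_of_mem_frakA hx
      exact Submodule.subset_span
        ⟨truncIdem n, truncIdem_mem_frakA n, x, hx, (truncIdem_mul_of_mem_In hn).symm⟩

lemma cClass_In (n : ℕ) : CClass RProd frakA (ModuleCat.of RProd (In n)) :=
  eq_top_iff.mpr fun x _ => Submodule.subset_span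
    ⟨truncIdem n, truncIdem_mem_frakA n, x, (truncIdem_smul_In (n := n) x).symm⟩

lemma tClass_frakA_iff (M : ModuleCat.{0} RProd) :
    TClass RProd frakA M ↔ ∀ (n : ℕ) (f : (In n) →ₗ[RProd] M), f = 0 := by
  constructor
  · intro h n f
    ext x
    rw [← truncIdem_smul_In x, map_smul, h _ (truncIdem_mem_frakA n), LinearMap.zero_apply]
  · intro h r hr m
    obtain ⟨n, hn⟩ := exists_mem_In_of_mem_frakA hr
    exact LinearMap.congr_fun
      (h n ((LinearMap.toSpanSingleton RProd M m).comp (In n).subtype)) ⟨r, hn⟩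

/-- **Example.** For `R = ∏_ℕ ℤ/2ℤ` and `𝔞 = ⊕_ℕ ℤ/2ℤ`: `𝔞` is a two-sided idempotent
ideal, each `I_n` is a finitely presented module with `𝔞 I_n = I_n` (so `I_n ∈ C_𝔞`),
the class `T_𝔞` is cut out by `Hom`-vanishing against the `I_n`, and consequently
`(C_𝔞, T_𝔞)` is a tCG torsion pair. -/
theorem prod_zmod2_CT_is_tCG :
    IsIdempotentTwoSidedIdeal RProd frakA ∧
    (∀ n : ℕ, Module.FinitePresentation RProd (In n)) ∧
    (∀ n : ℕ, CClass RProd frakA (ModuleCat.of RProd (In n))) ∧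
    (∀ M : ModuleCat.{0} RProd,
      TClass RProd frakA M ↔ ∀ (n : ℕ) (f : (In n) →ₗ[RProd] M), f = 0) ∧
    IsTCGTorsionPair RProd (CClass RProd frakA) (TClass RProd frakA) := by
  exact ⟨isIdempotentTwoSidedIdeal_frakA, finitePresentation_In, cClass_In, tClass_frakA_iff,
    ℕ, fun n => ModuleCat.of RProd (In n), finitePresentation_In, cClass_In, tClass_frakA_iff⟩
end

section
/- Let R = ∏_{n∈ℕ} ℤ/2ℤ with componentwise operations and let 𝔞 = ⊕_{n∈ℕ} ℤ/2ℤ be the two-sided idempotent ideal of finitely supported elements. Then there is no finitely presented R-module M such that Gen(M) = C_𝔞. -/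
open CategoryTheory Limits DirectSum

universe w u

variable (R : Type u) [Ring R]

/-- `M` is `V`-generated: some coproduct of copies of `V` surjects onto `M`. -/
def GenBy (V M : ModuleCat.{u} R) : Prop :=
  ∃ (I : Type u) (p : (⨁ _ : I, V) →ₗ[R] M), Function.Surjective p

/-- An element of `𝔞N` is annihilated by all but finitely many of the primitive idempotents. -/
lemma finite_single_smul_ne_zero {N : ModuleCat.{0} RProd} {m : N}
    (hm : m ∈ idealSMul RProd frakA N) :
    {n : ℕ | (Pi.single n 1 : RProd) • m ≠ 0}.Finite := by
  induction hm using Submodule.span_induction with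
  | mem x hx =>
    obtain ⟨r, hr, y, rfl⟩ := hx
    refine Set.Finite.subset hr fun n hn hrn => hn ?_
    have h : (Pi.single n 1 : RProd) * r = 0 := by
      rw [← Pi.single_mul_left, hrn, mul_zero, Pi.single_zero]
    rw [smul_smul, h, zero_smul]
  | zero => simp
  | add x y _ _ hx hy =>
    refine (hx.union hy).subset fun n hn => ?_
    by_contra h
    simp only [Set.mem_union, Set.mem_ofPred_eq, not_or, not_not] at h
    exact hn (by rw [smul_add, h.1, h.2, add_zero])
  | smul a x _ hx =>
    refine hx.subset fun n hn h => hn ?_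
    rw [smul_comm, h, smul_zero]

/-- A finitely generated module in `C_𝔞` is annihilated by some primitive idempotent. -/
lemma exists_single_smul_eq_zero {M : ModuleCat.{0} RProd} [Module.Finite RProd M]
    (hM : CClass RProd frakA M) :
    ∃ n : ℕ, ∀ m : M, (Pi.single n 1 : RProd) • m = 0 := by
  obtain ⟨s, hs⟩ := Module.Finite.fg_top (R := RProd) (M := M)
  have hfin : (⋃ m ∈ s, {n : ℕ | (Pi.single n 1 : RProd) • m ≠ 0}).Finite :=
    s.finite_toSet.biUnion fun m _ =>
      finite_single_smul_ne_zero (by rw [show idealSMul RProd frakA M = ⊤ from hM]; trivial)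
  obtain ⟨n, hn⟩ := hfin.exists_notMem
  simp only [Set.mem_iUnion, Set.mem_ofPred_eq, not_exists, not_not] at hn
  refine ⟨n, fun m => ?_⟩
  have hm : m ∈ Submodule.span RProd (s : Set M) := by rw [hs]; trivial
  induction hm using Submodule.span_induction with
  | mem x hx => exact hn x hx
  | zero => exact smul_zero _
  | add x y _ _ hx hy => rw [smul_add, hx, hy, add_zero]
  | smul a x _ hx => rw [smul_comm, hx, smul_zero]

lemma genBy_self (M : ModuleCat.{0} RProd) : GenBy RProd M M :=
  ⟨Unit, DirectSum.toModule RProd Unit M fun _ => LinearMap.id, fun m =>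
    ⟨DirectSum.lof RProd Unit (fun _ => M) () m, by simp [DirectSum.toModule_lof]⟩⟩

/-- An element annihilating `M` annihilates every `M`-generated module. -/
lemma GenBy.smul_eq_zero {M N : ModuleCat.{0} RProd} (h : GenBy RProd M N) {r : RProd}
    (hr : ∀ m : M, r • m = 0) (x : N) : r • x = 0 := by
  obtain ⟨I, p, hp⟩ := h
  obtain ⟨y, rfl⟩ := hp x
  rw [← map_smul, show r • y = 0 from DFinsupp.ext fun i => hr (y i), map_zero]

lemma single_mem_frakA (n : ℕ) : (Pi.single n 1 : RProd) ∈ frakA :=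
  (Set.finite_singleton n).subset Pi.support_single_subset

/-- The ideal `𝔞`, as a module, lies in `C_𝔞`. -/
lemma cClass_frakA : CClass RProd frakA (ModuleCat.of RProd frakA) := by
  refine eq_top_iff.2 fun x _ => Submodule.subset_span ⟨x.1, x.2, x, Subtype.ext ?_⟩
  funext n
  change x.1 n = x.1 n * x.1 n
  generalize x.1 n = a
  revert a
  decide

/-- **Remark.** For `R = ∏_ℕ ℤ/2ℤ` and `𝔞 = ⊕_ℕ ℤ/2ℤ`, there is no finitely presented
`R`-module `M` with `Gen(M) = C_𝔞`. -/
theorem prod_zmod2_no_fp_generator :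
    ¬ ∃ M : ModuleCat.{0} RProd, Module.FinitePresentation RProd M ∧
      ∀ N : ModuleCat.{0} RProd, GenBy RProd M N ↔ CClass RProd frakA N := by
  rintro ⟨M, hfp, hM⟩
  obtain ⟨n, hn⟩ := exists_single_smul_eq_zero ((hM M).1 (genBy_self M))
  have h := ((hM _).2 cClass_frakA).smul_eq_zero hn ⟨_, single_mem_frakA n⟩
  have h' : (Pi.single n 1 : RProd) n * (Pi.single n 1 : RProd) n = 0 :=
    congrFun (congrArg Subtype.val h) n
  simp at h'
end

section
/- Let R be an associative unital ring, let 𝔞 be a two-sided idempotent ideal of R, and let 𝒮_𝔞 be the class of left R-modules of the form 𝔞^{(n)}/(K ∩ 𝔞^{(n)}), where n ∈ ℕ and K is a finitely generated submodule of the free module R^{(n)} such that K + 𝔞^{(n)} = R^{(n)} (here 𝔞^{(n)} ⊆ R^{(n)} is the direct sum of n copies of 𝔞). Then the torsion pair (C_𝔞, T_𝔞) is a tCG torsion pair if and only if T_𝔞 = {M ∈ R-Mod : Hom_R(S, M) = 0 for all S ∈ 𝒮_𝔞}. -/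
open CategoryTheory Limits DirectSum

universe w u

variable (R : Type u) [Ring R]

/-- The class `𝒮_𝔞` of modules of the form `𝔞⁽ⁿ⁾/(K ∩ 𝔞⁽ⁿ⁾)` where `K` is a finitely
generated submodule of `R⁽ⁿ⁾` with `K + 𝔞⁽ⁿ⁾ = R⁽ⁿ⁾`. -/
def SClass (a : Submodule R R) : ModuleCat.{u} R → Prop := fun S =>
  ∃ (n : ℕ) (K : Submodule R (Fin n → R)), K.FG ∧
    K ⊔ Submodule.pi Set.univ (fun _ : Fin n => a) = ⊤ ∧
    Nonempty (S ≅ ModuleCat.of R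
      ((Submodule.pi Set.univ (fun _ : Fin n => a)) ⧸
        (K.comap (Submodule.pi Set.univ (fun _ : Fin n => a)).subtype)))

variable {R}

/-- A linear surjection from a finite free module carries `𝔞⁽ⁿ⁾` onto `𝔞M`. -/
lemma map_pi_eq_idealSMul {a : Submodule R R} (ha : ∀ x ∈ a, ∀ r : R, x * r ∈ a)
    {M : ModuleCat.{u} R} {n : ℕ} (g : (Fin n → R) →ₗ[R] M) (hg : Function.Surjective g) :
    (Submodule.pi Set.univ (fun _ : Fin n => a)).map g = idealSMul R a M := by
  apply le_antisymm
  · rintro _ ⟨x, hx, rfl⟩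
    rw [pi_eq_sum_univ' x, map_sum]
    refine Submodule.sum_mem _ fun i _ => Submodule.subset_span ?_
    exact ⟨x i, hx i (Set.mem_univ i), _, map_smul g _ _⟩
  · refine Submodule.span_le.mpr ?_
    rintro _ ⟨r, hr, m, rfl⟩
    obtain ⟨y, rfl⟩ := hg m
    exact ⟨r • y, fun i _ => ha r hr (y i), map_smul g _ _⟩

lemma cClass_iff_ker_sup_pi_eq_top {a : Submodule R R} (ha : ∀ x ∈ a, ∀ r : R, x * r ∈ a)
    {M : ModuleCat.{u} R} {n : ℕ} (g : (Fin n → R) →ₗ[R] M) (hg : Function.Surjective g) :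
    CClass R a M ↔ LinearMap.ker g ⊔ Submodule.pi Set.univ (fun _ : Fin n => a) = ⊤ := by
  rw [CClass, ← map_pi_eq_idealSMul ha g hg, sup_comm, ← Submodule.comap_map_eq]
  refine ⟨fun h => by rw [h, Submodule.comap_top], fun h => ?_⟩
  rw [← Submodule.map_comap_eq_of_surjective hg (Submodule.map g _), h, Submodule.map_top,
    LinearMap.range_eq_top.mpr hg]

/-- If `K + P` is the whole module `N`, then `P / (K ∩ P) ≃ N / K`. -/
noncomputable def quotientComapEquivOfSupEqTop {N : Type*} [AddCommGroup N] [Module R N]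
    (K P : Submodule R N) (h : K ⊔ P = ⊤) : (P ⧸ K.comap P.subtype) ≃ₗ[R] N ⧸ K :=
  (Submodule.quotEquivOfEq _ _ (by rw [LinearMap.ker_comp, Submodule.ker_mkQ])).trans
    ((K.mkQ ∘ₗ P.subtype).quotKerEquivOfSurjective (by
      rw [← LinearMap.range_eq_top, LinearMap.range_comp, Submodule.range_subtype,
        Submodule.map_mkQ_eq_top]
      exact h))

/-- The class `𝒮_𝔞` consists of the finitely presented modules in `C_𝔞`. -/
lemma sClass_iff {a : Submodule R R} (ha : ∀ x ∈ a, ∀ r : R, x * r ∈ a)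
    (S : ModuleCat.{u} R) :
    SClass R a S ↔ Module.FinitePresentation R S ∧ CClass R a S := by
  constructor
  · rintro ⟨n, K, hK, htop, ⟨i⟩⟩
    let e : ((Fin n → R) ⧸ K) ≃ₗ[R] S :=
      (i.toLinearEquiv.trans (quotientComapEquivOfSupEqTop K _ htop)).symm
    let g : (Fin n → R) →ₗ[R] S := e.toLinearMap ∘ₗ K.mkQ
    have hg : Function.Surjective g := e.surjective.comp K.mkQ_surjective
    have hker : LinearMap.ker g = K := by
      rw [LinearEquiv.ker_comp, Submodule.ker_mkQ]
    exact ⟨Module.finitePresentation_of_surjective g hg (hker.symm ▸ hK),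
      (cClass_iff_ker_sup_pi_eq_top ha g hg).mpr (hker.symm ▸ htop)⟩
  · rintro ⟨_, hS⟩
    obtain ⟨n, K, e, hK⟩ := Module.FinitePresentation.exists_fin R S
    let g : (Fin n → R) →ₗ[R] S := e.symm.toLinearMap ∘ₗ K.mkQ
    have hg : Function.Surjective g := e.symm.surjective.comp K.mkQ_surjective
    have hker : LinearMap.ker g = K := by
      rw [LinearEquiv.ker_comp, Submodule.ker_mkQ]
    have htop := (cClass_iff_ker_sup_pi_eq_top ha g hg).mp hS
    rw [hker] at htop
    exact ⟨n, K, hK, htop,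
      ⟨(e.trans (quotientComapEquivOfSupEqTop K _ htop).symm).toModuleIso⟩⟩

/-- There are no nonzero maps from `C_𝔞` to `T_𝔞`. -/
lemma eq_zero_of_cClass_of_tClass {a : Submodule R R} {S M : ModuleCat.{u} R}
    (hS : CClass R a S) (hM : TClass R a M) (f : S →ₗ[R] M) : f = 0 := by
  rw [← LinearMap.ker_eq_top, eq_top_iff, ← hS]
  refine Submodule.span_le.mpr ?_
  rintro _ ⟨r, hr, m, rfl⟩
  exact (map_smul f r m).trans (hM r hr (f m))

variable (R)

/-- **Theorem.** For a two-sided idempotent ideal `𝔞`, the torsion pair `(C_𝔞, T_𝔞)` is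
tCG if and only if `T_𝔞` is exactly the class of modules receiving no nonzero map from
any member of `𝒮_𝔞`. -/
theorem ttf_left_tCG_iff (a : Submodule R R) (ha : IsIdempotentTwoSidedIdeal R a) :
    IsTCGTorsionPair R (CClass R a) (TClass R a) ↔
      ∀ M : ModuleCat.{u} R, TClass R a M ↔
        ∀ S : ModuleCat.{u} R, SClass R a S → ∀ f : S →ₗ[R] M, f = 0 := by
  constructor
  · rintro ⟨Λ, Tfam, hfp, hC, hF⟩ M
    refine ⟨fun hM S hS f => ?_, fun h => (hF M).mpr fun l => ?_⟩
    · exact eq_zero_of_cClass_of_tClass ((sClass_iff ha.mul_mem_right S).mp hS).2 hM f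
    · exact h _ ((sClass_iff ha.mul_mem_right _).mpr ⟨hfp l, hC l⟩)
  · intro h
    let Λ : Type u := Σ n : ℕ, {K : Submodule R (Fin n → R) //
      K.FG ∧ K ⊔ Submodule.pi Set.univ (fun _ : Fin n => a) = ⊤}
    let Tfam : Λ → ModuleCat.{u} R := fun l => ModuleCat.of R
      ((Submodule.pi Set.univ (fun _ : Fin l.1 => a)) ⧸
        (l.2.1.comap (Submodule.pi Set.univ (fun _ : Fin l.1 => a)).subtype))
    have hT : ∀ l, SClass R a (Tfam l) := fun l =>
      ⟨l.1, l.2.1, l.2.2.1, l.2.2.2, ⟨Iso.refl _⟩⟩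
    refine ⟨Λ, Tfam, fun l => ((sClass_iff ha.mul_mem_right _).mp (hT l)).1,
      fun l => ((sClass_iff ha.mul_mem_right _).mp (hT l)).2, fun M => (h M).trans ?_⟩
    refine ⟨fun hM l => hM _ (hT l), ?_⟩
    rintro hM S ⟨n, K, hK, htop, ⟨i⟩⟩ f
    have hf := hM ⟨n, K, hK, htop⟩ (f ∘ₗ i.toLinearEquiv.symm.toLinearMap)
    ext x
    simpa using LinearMap.congr_fun hf (i.toLinearEquiv x)
end

section
/- Let R be an associative unital ring and let 𝔞 be a two-sided idempotent ideal of R contained in the Jacobson radical of R. Then every finitely presented left R-module M with 𝔞M = M is zero; that is, C_𝔞 ∩ fp(R-Mod) = 0. Consequently, if 𝔞 ≠ 0 (equivalently, if 𝔞 is not finitely generated), then the torsion pair (C_𝔞, T_𝔞) is not a tCG torsion pair. -/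
open CategoryTheory Limits DirectSum

universe w u

variable (R : Type u) [Ring R]

/-- If `a` is contained in the Jacobson radical, then `aM` is contained in the Jacobson
radical of `M`. -/
theorem idealSMul_le_jacobson {a : Submodule R R} (hj : a ≤ (⊥ : Ideal R).jacobson)
    (M : ModuleCat.{u} R) : idealSMul R a M ≤ Module.jacobson R M := by
  rw [Ideal.jacobson_bot] at hj
  refine Submodule.span_le.mpr ?_
  rintro _ ⟨r, hr, m, rfl⟩
  exact Ring.jacobson_smul_top_le R M (Submodule.smul_mem_smul (hj hr) Submodule.mem_top)

/-- **Nakayama's lemma**: if `a` is contained in the Jacobson radical, then a finitely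
generated module in `C_a` is zero. -/
theorem CClass.subsingleton_of_finite {a : Submodule R R}
    (hj : a ≤ (⊥ : Ideal R).jacobson) (M : ModuleCat.{u} R) [Module.Finite R M]
    (hM : CClass R a M) : Subsingleton M := by
  by_contra h
  rw [not_subsingleton_iff_nontrivial] at h
  exact (Module.jacobson_lt_top R M).not_ge (hM.ge.trans (idealSMul_le_jacobson R hj M))

/-- **Corollary.** If `𝔞` is a two-sided idempotent ideal contained in the Jacobson
radical of `R`, then every finitely presented module `M` with `𝔞M = M` is zero; and
consequently, if `𝔞 ≠ 0`, the torsion pair `(C_𝔞, T_𝔞)` is not tCG. -/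
theorem jacobson_idempotent_no_fp (a : Submodule R R)
    (ha : IsIdempotentTwoSidedIdeal R a)
    (hj : a ≤ (⊥ : Ideal R).jacobson) :
    (∀ M : ModuleCat.{u} R, Module.FinitePresentation R M → CClass R a M →
      Subsingleton M) ∧
    (a ≠ ⊥ → ¬ IsTCGTorsionPair R (CClass R a) (TClass R a)) := by
  have hfp : ∀ M : ModuleCat.{u} R, Module.FinitePresentation R M → CClass R a M →
      Subsingleton M := fun M _ hM => CClass.subsingleton_of_finite R hj M hM
  refine ⟨hfp, ?_⟩
  rintro hne ⟨Λ, Tfam, hT, hC, hF⟩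
  refine hne (a.eq_bot_iff.mpr fun r hr => ?_)
  have hR : TClass R a (ModuleCat.of R R) := (hF _).mpr fun l f => by
    have := hfp (Tfam l) (hT l) (hC l)
    exact Subsingleton.elim f 0
  simpa using hR r hr (1 : R)
end
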